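/- Let n ≥ 2 and let I be a permutation of {1,…,n}. Then Θ(N_I^+) · Φ((q−ħ)T^{1/2}_I) / Θ(T^{1/2}_I) = (det N_I^+ / det T^{1/2}_I)^{1/2} · Φ((q−ħ)N_I^+), for all parameter values (u_1,…,u_n, ħ, q with 0<|q|<1) at which every infinite product and theta factor appearing is nonzero; here the square root of the Laurent monomial det N_I^+ / det T^{1/2}_I is the corresponding monomial in the chosen square roots of the u_i, ħ and q. -/

import Mathlib

noncomputable section
open scoped BigOperators

/-- `φ(x) = ∏_{i=0}^∞ (1 − x qⁱ)`. -/
def phiP (q x : ℂ) : ℂ := ∏' i : ℕ, (1 - x * q ^ i)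

/-- The odd Jacobi theta function `ϑ(x) = (x^{1/2} − x^{−1/2}) φ(qx) φ(q/x)`,
expressed in terms of the chosen square root `y = x^{1/2}` of `x = y²`. -/
def thetaH (q y : ℂ) : ℂ := (y - y⁻¹) * phiP q (q * y ^ 2) * phiP q (q / y ^ 2)
/-- The (0-based) value `I_{k+1} - 1` of a permutation `I` of `{1,…,n}` at the
(0-based) position `k`; junk value `0` if `k ≥ n`. -/
def pval (n : ℕ) (I : Equiv.Perm (Fin n)) (k : ℕ) : ℕ :=
  if h : k < n then ((I ⟨k, h⟩ : Fin n) : ℕ) else 0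

/-- The `a`-th smallest (0-based position `a`) element of `{I_1,…,I_k}`, with all
values recorded 0-based: this is `i^{(k)}_{a+1} - 1` in the notation of the paper. -/
def ordIdx (n : ℕ) (I : Equiv.Perm (Fin n)) (k a : ℕ) : ℕ :=
  (((Finset.range k).image (pval n I)).sort (· ≤ ·)).getD a 0

/-- `j(I,k,a)`: the 0-based position `j` with `I_j = i^{(k)}_a`. -/
def jIdx (n : ℕ) (I : Equiv.Perm (Fin n)) (k a : ℕ) : ℕ :=
  if h : ordIdx n I k a < n then ((I.symm ⟨ordIdx n I k a, h⟩ : Fin n) : ℕ) else 0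

/-- The set of pairs `(j,k)` of 0-based indices with `0 ≤ j < k ≤ n-1`. -/
def pairsN (n : ℕ) : Finset (ℕ × ℕ) :=
  (Finset.range n ×ˢ Finset.range n).filter (fun p => p.1 < p.2)

/-- The order `I ≺ J`:  `i^{(k)}_m ≤ j^{(k)}_m` for all `1 ≤ k ≤ n-1`, `1 ≤ m ≤ k`. -/
def prec (n : ℕ) (I J : Equiv.Perm (Fin n)) : Prop :=
  ∀ k, 1 ≤ k → k ≤ n - 1 → ∀ m, m < k → ordIdx n I k m ≤ ordIdx n J k m
theorem phiP_step (q x : ℂ) (hq1 : ‖q‖ < 1) : phiP q x = (1 - x) * phiP q (q * x) := by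
  have hm : Multipliable (fun i : ℕ => 1 - (q * x) * q ^ i) := by
    have hs : Summable (fun i : ℕ => ‖-((q * x) * q ^ i)‖) := by
      simp only [norm_neg, norm_mul, norm_pow]
      exact (summable_geometric_of_lt_one (norm_nonneg _) hq1).mul_left _
    simpa [sub_eq_add_neg] using multipliable_one_add_of_summable hs
  have e : (fun i : ℕ => 1 - x * q ^ (i + 1)) = fun i : ℕ => 1 - (q * x) * q ^ i := by
    funext i; ring
  unfold phiP
  have := tprod_eq_zero_mul' (f := fun i : ℕ => 1 - x * q ^ i) (by rw [e]; exact hm)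
  rw [this, e]; simp

theorem pair_identity (q h sh a b : ℂ) (hq1 : ‖q‖ < 1) (hsh : sh ^ 2 = h)
    (hθ : thetaH q (b / a) ≠ 0) (hφ1 : phiP q (h * b ^ 2 / a ^ 2) ≠ 0)
    (hφ2 : phiP q (a ^ 2 / b ^ 2) ≠ 0) :
    thetaH q (sh⁻¹ * a / b) * (phiP q (q * b ^ 2 / a ^ 2) / phiP q (h * b ^ 2 / a ^ 2)) /
      thetaH q (b / a) =
    sh⁻¹ * a ^ 2 / b ^ 2 * (phiP q (q * h⁻¹ * a ^ 2 / b ^ 2) / phiP q (a ^ 2 / b ^ 2)) := by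
  have ha : a ≠ 0 := by rintro rfl; simp [thetaH] at hθ
  have hb : b ≠ 0 := by rintro rfl; simp [thetaH] at hθ
  by_cases hs : sh = 0
  · subst hs; simp [thetaH]
  subst hsh
  have s1 := phiP_step q (sh ^ 2 * b ^ 2 / a ^ 2) hq1
  have s2 := phiP_step q (a ^ 2 / b ^ 2) hq1
  have t1 : thetaH q (sh⁻¹ * a / b) = (sh⁻¹ * a / b) * (1 - sh ^ 2 * b ^ 2 / a ^ 2) *
      phiP q (q * (sh ^ 2)⁻¹ * a ^ 2 / b ^ 2) * phiP q (q * (sh ^ 2 * b ^ 2 / a ^ 2)) := by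
    unfold thetaH
    congr 1
    · congr 1
      · field_simp
      · congr 1; field_simp
    · congr 1; field_simp
  have t2 : thetaH q (b / a) = (b / a) * (1 - a ^ 2 / b ^ 2) *
      phiP q (q * b ^ 2 / a ^ 2) * phiP q (q * (a ^ 2 / b ^ 2)) := by
    unfold thetaH
    congr 1
    · congr 1
      · field_simp
      · congr 1; field_simp
    · congr 1; field_simp
  have t1' : thetaH q (sh⁻¹ * a / b) = (sh⁻¹ * a / b) *
      phiP q (q * (sh ^ 2)⁻¹ * a ^ 2 / b ^ 2) * phiP q (sh ^ 2 * b ^ 2 / a ^ 2) := by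
    rw [t1, s1]; ring
  have t2' : thetaH q (b / a) = (b / a) * phiP q (q * b ^ 2 / a ^ 2) * phiP q (a ^ 2 / b ^ 2) := by
    rw [t2, s2]; ring
  have hφ3 : phiP q (q * b ^ 2 / a ^ 2) ≠ 0 := by
    intro h0; rw [t2', h0] at hθ; simp at hθ
  rw [t1', t2']
  generalize phiP q (q * b ^ 2 / a ^ 2) = A at *
  generalize phiP q (a ^ 2 / b ^ 2) = B at *
  generalize phiP q (sh ^ 2 * b ^ 2 / a ^ 2) = C at *
  generalize phiP q (q * (sh ^ 2)⁻¹ * a ^ 2 / b ^ 2) = D at *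
  field_simp

theorem pval_lt (n : ℕ) (hn : 2 ≤ n) (I : Equiv.Perm (Fin n)) (k : ℕ) : pval n I k < n := by
  unfold pval
  split_ifs
  · exact Fin.is_lt _
  · omega

/-- Lemma `lem` of the paper: for the cotangent bundle of the complete flag variety,
`Θ(N_I^+) Φ((q−ħ)T^{1/2}_I) / Θ(T^{1/2}_I) = (det N_I^+ / det T^{1/2}_I)^{1/2} Φ((q−ħ)N_I^+)`,
where the square root of the Laurent monomial `det N_I^+ / det T^{1/2}_I` is the
corresponding monomial in the chosen square roots `su i` of `u_{i+1}` and `sh` of `ħ`. -/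
theorem theta_phi_polarization_identity
    (n : ℕ) (hn : 2 ≤ n) (I : Equiv.Perm (Fin n))
    (q sq h sh : ℂ) (u su : ℕ → ℂ)
    (hq0 : 0 < ‖q‖) (hq1 : ‖q‖ < 1)
    (hsq : sq ^ 2 = q) (hsh : sh ^ 2 = h) (hsu : ∀ i, i < n → (su i) ^ 2 = u i)
    (hθ : ∀ p ∈ pairsN n, thetaH q (su (pval n I p.2) / su (pval n I p.1)) ≠ 0)
    (hφ1 : ∀ p ∈ pairsN n, phiP q (h * u (pval n I p.2) / u (pval n I p.1)) ≠ 0)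
    (hφ2 : ∀ p ∈ pairsN n, phiP q (u (pval n I p.1) / u (pval n I p.2)) ≠ 0)
    (hφ3 : ∀ p ∈ pairsN n, phiP q (q * u (pval n I p.2) / u (pval n I p.1)) ≠ 0)
    (hφ4 : ∀ p ∈ pairsN n, phiP q (q * h⁻¹ * u (pval n I p.1) / u (pval n I p.2)) ≠ 0) :
    (∏ p ∈ pairsN n,
        (if pval n I p.2 < pval n I p.1 then
          thetaH q (su (pval n I p.2) / su (pval n I p.1))
        else thetaH q (sh⁻¹ * su (pval n I p.1) / su (pval n I p.2)))) *
      (∏ p ∈ pairsN n,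
        phiP q (q * u (pval n I p.2) / u (pval n I p.1)) /
          phiP q (h * u (pval n I p.2) / u (pval n I p.1))) /
      (∏ p ∈ pairsN n, thetaH q (su (pval n I p.2) / su (pval n I p.1))) =
    (∏ p ∈ pairsN n,
        (if pval n I p.2 < pval n I p.1 then (1 : ℂ)
         else sh⁻¹ * (su (pval n I p.1)) ^ 2 / (su (pval n I p.2)) ^ 2)) *
      (∏ p ∈ pairsN n,
        (if pval n I p.2 < pval n I p.1 then
          phiP q (q * u (pval n I p.2) / u (pval n I p.1)) /
            phiP q (h * u (pval n I p.2) / u (pval n I p.1))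
        else phiP q (q * h⁻¹ * u (pval n I p.1) / u (pval n I p.2)) /
          phiP q (u (pval n I p.1) / u (pval n I p.2)))) := by
  rw [← Finset.prod_mul_distrib, ← Finset.prod_div_distrib, ← Finset.prod_mul_distrib]
  refine Finset.prod_congr rfl fun p hp => ?_
  have h1 := hθ p hp
  have h2 := hφ1 p hp
  have h3 := hφ2 p hp
  rw [← hsu _ (pval_lt n hn I p.1), ← hsu _ (pval_lt n hn I p.2)] at *
  split_ifs with hlt
  · rw [one_mul, mul_div_assoc, mul_comm, div_mul_cancel₀ _ h1]
  · exact pair_identity q h sh _ _ hq1 hsh h1 h2 h3
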